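/- arXiv:2007.00172 — 2 statements merged into one kernel-verified Lean document; each statement's English description precedes it below -/
import Mathlib

section
/- Let g_1, ..., g_r ∈ ℚ[u] and let f_1, ..., f_r ∈ ℚ[u] be monic polynomials such that f_i(n) ≠ 0 for all positive integers n. If for every 1 ≤ s ≤ r one has Σ_{i=s}^r (deg f_i - deg g_i) ≥ r - s + 2, then the multiple series Σ_{0 < n_1 < n_2 < ... < n_r} g_1(n_1)g_2(n_2-n_1)⋯g_r(n_r-n_{r-1}) / (f_1(n_1)f_2(n_2)⋯f_r(n_r)) converges absolutely. -/
open Polynomial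

/-- The value of the variable preceding index `i` (with `n_0 = 0`). -/
def prevVal {r : ℕ} (n : Fin r → ℕ+) (i : Fin r) : ℝ :=
  if h : (i : ℕ) = 0 then 0 else (n ⟨(i : ℕ) - 1, by have := i.isLt; omega⟩ : ℝ)

lemma abel_aux : ∀ (r : ℕ) (e x : Fin r → ℝ), Monotone x →
    (∀ s : Fin r, 0 ≤ ∑ i ∈ Finset.univ.filter (fun i => s ≤ i), e i) →
    ∀ c : ℝ, (∀ i, c ≤ x i) → c * ∑ i, e i ≤ ∑ i, e i * x i := by
  intro r
  induction r with
  | zero => intro e x _ _ c _; simp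
  | succ r ih =>
    intro e x hx he c hc
    have h0 : 0 ≤ ∑ i, e i := by
      have := he 0
      simpa using this
    have h1 := ih (fun i => e i.succ) (fun i => x i.succ)
      (fun i j hij => hx (Fin.succ_le_succ_iff.mpr hij)) (by
        intro s
        have := he s.succ
        rw [Finset.sum_filter, Fin.sum_univ_succ] at this
        rw [Finset.sum_filter]
        simpa [Fin.succ_le_succ_iff] using this) (x 0) (fun i => hx (Fin.zero_le _))
    have h2 : c * ∑ i, e i ≤ x 0 * ∑ i, e i := mul_le_mul_of_nonneg_right (hc 0) h0
    rw [Fin.sum_univ_succ (fun i => e i * x i)]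
    rw [Fin.sum_univ_succ e] at h2 ⊢
    nlinarith

lemma summable_pi_aux (u : ℕ+ → ℝ) (hu : Summable u) (h0 : ∀ n, 0 ≤ u n) :
    ∀ r : ℕ, Summable (fun n : Fin r → ℕ+ => ∏ i, u (n i)) := by
  intro r
  induction r with
  | zero => exact Summable.of_finite
  | succ r ih =>
    have := hu.mul_of_nonneg ih h0 (fun n => Finset.prod_nonneg fun i _ => h0 _)
    rw [← (Fin.consEquiv (fun _ : Fin (r+1) => ℕ+)).summable_iff]
    refine this.congr ?_
    rintro ⟨a, b⟩
    simp [Fin.prod_univ_succ, Fin.consEquiv]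

lemma upper_aux (g : Polynomial ℚ) : ∃ C : ℝ, 0 < C ∧ ∀ m : ℕ, 1 ≤ m →
    |Polynomial.aeval (m : ℝ) g| ≤ C * (m : ℝ) ^ g.natDegree := by
  have h := Polynomial.isBigO_atTop_of_degree_le (g.map (algebraMap ℚ ℝ)) (X ^ g.natDegree)
    (by rw [degree_X_pow]; exact degree_map_le.trans degree_le_natDegree)
  obtain ⟨C, hC, hb⟩ := Asymptotics.bound_of_isBigO_nat_atTop
    (h.comp_tendsto tendsto_natCast_atTop_atTop)
  refine ⟨C, hC, fun m hm => ?_⟩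
  have hm' : (m : ℝ) ≠ 0 := by positivity
  have := @hb m (by simp [hm'])
  simpa [Polynomial.eval_map_algebraMap] using this

lemma lower_aux (f : Polynomial ℚ) (hf : f.Monic) (hne : ∀ n : ℕ+, f.eval (n : ℚ) ≠ 0) :
    ∃ C : ℝ, 0 < C ∧ ∀ n : ℕ+, Polynomial.aeval (n : ℝ) f ≠ 0 ∧
      (n : ℝ) ^ f.natDegree ≤ C * |Polynomial.aeval (n : ℝ) f| := by
  have h := Polynomial.isBigO_atTop_of_degree_le (X ^ f.natDegree) (f.map (algebraMap ℚ ℝ))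
    (by rw [degree_X_pow, degree_map, degree_eq_natDegree hf.ne_zero])
  obtain ⟨C, hC, hb⟩ := Asymptotics.bound_of_isBigO_nat_atTop
    (h.comp_tendsto tendsto_natCast_atTop_atTop)
  refine ⟨C, hC, fun n => ?_⟩
  have hn : Polynomial.aeval (n : ℝ) f ≠ 0 := by
    have h1 : Polynomial.aeval (n : ℝ) f = ((f.eval (n : ℚ) : ℚ) : ℝ) := by
      have := Polynomial.aeval_algebraMap_apply ℝ ((n : ℕ) : ℚ) f
      simpa using this
    rw [h1]
    exact_mod_cast hne n
  refine ⟨hn, ?_⟩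
  have := @hb (n : ℕ) (by simpa [Polynomial.eval_map_algebraMap] using hn)
  simpa [Polynomial.eval_map_algebraMap] using this

lemma factor_aux (f g : Polynomial ℚ) (hf : f.Monic)
    (hne : ∀ n : ℕ+, f.eval (n : ℚ) ≠ 0) :
    ∃ C : ℝ, 0 < C ∧ ∀ (n : ℕ+) (m : ℕ), 1 ≤ m → m ≤ n →
      |Polynomial.aeval (m : ℝ) g| / |Polynomial.aeval (n : ℝ) f| ≤
        C * Real.exp (-((f.natDegree : ℝ) - g.natDegree) * Real.log n) := by
  obtain ⟨A, hA, hg⟩ := upper_aux g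
  obtain ⟨B, hB, hf'⟩ := lower_aux f hf hne
  refine ⟨A * B, by positivity, fun n m h1 h2 => ?_⟩
  obtain ⟨h3, h4⟩ := hf' n
  have hn : (0 : ℝ) < n := by exact_mod_cast n.pos
  have h5 : Real.exp (-((f.natDegree : ℝ) - g.natDegree) * Real.log n)
      = (n : ℝ) ^ g.natDegree / (n : ℝ) ^ f.natDegree := by
    rw [← Real.rpow_natCast, ← Real.rpow_natCast, ← Real.rpow_sub hn, Real.rpow_def_of_pos hn]
    congr 1; ring
  have h6 : (m : ℝ) ^ g.natDegree ≤ (n : ℝ) ^ g.natDegree := by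
    gcongr
  have h7 := hg m h1
  have h8 : 0 < |Polynomial.aeval (n : ℝ) f| := abs_pos.mpr h3
  rw [h5, ← mul_div_assoc, div_le_div_iff₀ h8 (by positivity)]
  calc _ ≤ (A * (n : ℝ) ^ g.natDegree) * (B * |Polynomial.aeval (n : ℝ) f|) := by
        gcongr
        exact h7.trans (by gcongr)
    _ = _ := by ring

/-- Absolute convergence of Σ_{0<n₁<⋯<n_r} ∏ g_i(n_i - n_{i-1}) / ∏ f_i(n_i)
under the degree conditions. -/
theorem stmt_7 (r : ℕ) (hr : 1 ≤ r) (f g : Fin r → Polynomial ℚ)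
    (hmonic : ∀ i, (f i).Monic)
    (hne : ∀ (i : Fin r) (n : ℕ+), (f i).eval (n : ℚ) ≠ 0)
    (hdeg : ∀ s : Fin r, (r : ℤ) - (s : ℕ) + 1 ≤
      ∑ i ∈ Finset.univ.filter (fun i => s ≤ i),
        (((f i).natDegree : ℤ) - ((g i).natDegree : ℤ))) :
    Summable (fun n : {n : Fin r → ℕ+ // StrictMono n} =>
      |(∏ i : Fin r, Polynomial.aeval ((n.1 i : ℝ) - prevVal n.1 i) (g i)) /
        ∏ i : Fin r, Polynomial.aeval ((n.1 i : ℝ)) (f i)|) := by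
  choose C hC hb using fun i => factor_aux (f i) (g i) (hmonic i) (hne i)
  have hr0 : (0 : ℝ) < r := by exact_mod_cast hr
  set p : ℝ := 1 + 1 / r with hp
  have hp1 : 1 < p := by rw [hp]; have : 0 < 1 / (r : ℝ) := by positivity
                         linarith
  let u : ℕ+ → ℝ := fun n => Real.exp (-p * Real.log n)
  have hu : Summable u := by
    have h := (Real.summable_nat_rpow_inv.mpr hp1).comp_injective PNat.coe_injective
    refine h.congr fun n => ?_
    have hn : (0 : ℝ) < n := by exact_mod_cast n.pos
    simp only [u, Function.comp]
    rw [← Real.rpow_neg hn.le, Real.rpow_def_of_pos hn, mul_comm]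
  have hS := (summable_pi_aux u hu (fun n => (Real.exp_pos _).le) r)
  have hS2 := (hS.comp_injective
    (Subtype.val_injective (p := fun n : Fin r → ℕ+ => StrictMono n))).mul_left (∏ i, C i)
  refine hS2.of_nonneg_of_le (fun _ => abs_nonneg _) ?_
  rintro ⟨n, hn⟩
  simp only [Function.comp]
  rw [abs_div, Finset.abs_prod, Finset.abs_prod, ← Finset.prod_div_distrib]
  have step1 : ∀ i, |Polynomial.aeval ((n i : ℝ) - prevVal n i) (g i)| /
      |Polynomial.aeval (n i : ℝ) (f i)| ≤ C i *
        Real.exp (-(((f i).natDegree : ℝ) - (g i).natDegree) * Real.log (n i)) := by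
    intro i
    have : ∃ m : ℕ, 1 ≤ m ∧ m ≤ (n i : ℕ) ∧ (n i : ℝ) - prevVal n i = m := by
      unfold prevVal
      split_ifs with h
      · exact ⟨n i, (n i).pos, le_rfl, by simp⟩
      · have hlt : n ⟨(i : ℕ) - 1, by have := i.isLt; omega⟩ < n i := by
          apply hn
          rw [Fin.lt_def]
          simp only
          omega
        have hlt' := PNat.coe_lt_coe _ _ |>.mpr hlt
        refine ⟨n i - n ⟨(i : ℕ) - 1, by have := i.isLt; omega⟩, by omega, by omega, ?_⟩
        rw [Nat.cast_sub hlt'.le]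
    obtain ⟨m, h1, h2, h3⟩ := this
    rw [h3]
    exact hb i (n i) m h1 h2
  refine (Finset.prod_le_prod (fun i _ => by positivity) (fun i _ => step1 i)).trans ?_
  rw [Finset.prod_mul_distrib]
  refine mul_le_mul_of_nonneg_left ?_ (Finset.prod_nonneg fun i _ => (hC i).le)
  simp only [u]
  rw [← Real.exp_sum, ← Real.exp_sum, Real.exp_le_exp]
  have key := abel_aux r (fun i => ((f i).natDegree : ℝ) - (g i).natDegree - p)
    (fun i => Real.log (n i)) (by
      intro i j hij
      apply Real.log_le_log
      · exact_mod_cast (n i).pos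
      · exact_mod_cast hn.monotone hij) (by
      intro s
      have h := hdeg s
      have h' : (r : ℝ) - (s : ℕ) + 1 ≤ ∑ i ∈ Finset.univ.filter (fun i => s ≤ i),
        (((f i).natDegree : ℝ) - ((g i).natDegree : ℝ)) := by exact_mod_cast h
      rw [Finset.sum_sub_distrib, Finset.sum_const, nsmul_eq_mul]
      have hcard : (Finset.univ.filter (fun i => s ≤ i)).card = r - (s : ℕ) := by
        rw [← Fin.card_Ici]; congr 1; ext; simp
      rw [hcard, Nat.cast_sub s.isLt.le]
      have hs : ((r : ℝ) - (s : ℕ)) * p ≤ (r : ℝ) - (s : ℕ) + 1 := by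
        have : ((r : ℝ) - (s : ℕ)) * (1 / r) ≤ 1 := by
          rw [mul_one_div, div_le_one hr0]
          have : (0 : ℝ) ≤ (s : ℕ) := by positivity
          linarith
        rw [hp]; linarith
      linarith) 0 (fun i => Real.log_natCast_nonneg _)
  rw [zero_mul] at key
  rw [← sub_nonneg, ← Finset.sum_sub_distrib]
  refine key.trans_eq (Finset.sum_congr rfl fun i _ => by ring)
end

section
/- Let c_1, ..., c_r be nonnegative integers, k_1, ..., k_{r-1} ≥ 1, and k_r ≥ 2. Then the series S = Σ_{0<n_1<...<n_r} 1/((n_1+c_1)^{k_1}⋯(n_r+c_r)^{k_r}) converges, and S is a ℚ-linear combination of multiple zeta values of weight at most k_1+...+k_r and depth at most r. -/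
/-- The set of multiple zeta values of weight at most `w` and depth at most `d`
(including 1 as the empty multiple zeta value). -/
def mzvSet (w d : ℕ) : Set ℝ :=
  {x | ∃ (r : ℕ) (k : Fin r → ℕ), (∀ i, 1 ≤ k i) ∧
    (∀ i : Fin r, (i : ℕ) = r - 1 → 2 ≤ k i) ∧ (∑ i, k i) ≤ w ∧ r ≤ d ∧
    x = ∑' n : {n : Fin r → ℕ+ // StrictMono n}, ∏ i, ((n.1 i : ℝ))⁻¹ ^ (k i)}

namespace MZVaux

open Filter Topology

/-- The basic function `m ↦ (m+1+c)^{-k}`. -/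
noncomputable def U (c k : ℕ) : ℕ → ℝ := fun m => ((m : ℝ) + 1 + c)⁻¹ ^ k

/-- Partial summation as a linear map. -/
noncomputable def sumOp : (ℕ → ℝ) →ₗ[ℚ] (ℕ → ℝ) where
  toFun f := fun M => ∑ m ∈ Finset.range M, f m
  map_add' f g := by ext M; simp [Finset.sum_add_distrib]
  map_smul' q f := by ext M; simp [Finset.smul_sum]

theorem sumOp_apply (f : ℕ → ℝ) (M : ℕ) : sumOp f M = ∑ m ∈ Finset.range M, f m := rfl

/-- Truncated multiple harmonic sums; the head of the list is the outermost exponent. -/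
noncomputable def h : List ℕ → ℕ → ℝ
  | [] => 1
  | k :: l => sumOp (U 0 k * h l)

/-- Right multiplication. -/
noncomputable def mulOp (g : ℕ → ℝ) : (ℕ → ℝ) →ₗ[ℚ] (ℕ → ℝ) where
  toFun f := f * g
  map_add' f f' := by ext M; simp [add_mul]
  map_smul' q f := by ext M; simp

theorem mulOp_apply (f g : ℕ → ℝ) : mulOp g f = f * g := rfl

/-- Rational functions vanishing at infinity. -/
noncomputable def P (w : ℕ) : Submodule ℚ (ℕ → ℝ) :=
  Submodule.span ℚ {x | ∃ c k, 1 ≤ k ∧ k ≤ w ∧ x = U c k}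

/-- Rational functions vanishing to second order at infinity. -/
noncomputable def P' (w : ℕ) : Submodule ℚ (ℕ → ℝ) :=
  Submodule.span ℚ ({x | ∃ c k, 2 ≤ k ∧ k ≤ w ∧ x = U c k} ∪ {x | ∃ c, x = U c 1 - U (c + 1) 1})

noncomputable def Mod (w d : ℕ) : Submodule ℚ (ℕ → ℝ) :=
  Submodule.span ℚ {x | ∃ (c k : ℕ) (l : List ℕ), (∀ j ∈ l, 1 ≤ j) ∧ k + l.sum ≤ w ∧
    l.length ≤ d ∧ x = U c k * h l}

theorem U_mul_same (c a b : ℕ) : U c a * U c b = U c (a + b) := by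
  ext m; simp only [U, Pi.mul_apply, pow_add]

theorem U_zero (c : ℕ) : U c 0 = 1 := by
  ext m; simp [U]

theorem U_mem_P' {c k w : ℕ} (h2 : 2 ≤ k) (hw : k ≤ w) : U c k ∈ P' w :=
  Submodule.subset_span (Or.inl ⟨c, k, h2, hw, rfl⟩)

theorem P'_le_P {w : ℕ} (hw : 1 ≤ w) : P' w ≤ P w := by
  refine Submodule.span_le.2 ?_
  rintro x (⟨c, k, h2, hk, rfl⟩ | ⟨c, rfl⟩)
  · exact Submodule.subset_span ⟨c, k, by omega, hk, rfl⟩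
  · exact Submodule.sub_mem _ (Submodule.subset_span ⟨c, 1, le_rfl, hw, rfl⟩)
      (Submodule.subset_span ⟨c + 1, 1, le_rfl, hw, rfl⟩)

theorem P'_mono {w w' : ℕ} (hw : w ≤ w') : P' w ≤ P' w' := by
  refine Submodule.span_mono ?_
  rintro x (⟨c, k, h2, hk, rfl⟩ | ⟨c, rfl⟩)
  · exact Or.inl ⟨c, k, h2, hk.trans hw, rfl⟩
  · exact Or.inr ⟨c, rfl⟩

theorem diff_mem (w c e : ℕ) : U c 1 - U (c + e) 1 ∈ P' w := by
  induction e with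
  | zero => simp
  | succ e ih =>
    have : U c 1 - U (c + (e + 1)) 1 = (U c 1 - U (c + e) 1) + (U (c + e) 1 - U (c + e + 1) 1) := by
      rw [← add_assoc]; abel
    rw [this]
    exact Submodule.add_mem _ ih (Submodule.subset_span (Or.inr ⟨c + e, rfl⟩))

theorem diff_mem' (w c d : ℕ) : U c 1 - U d 1 ∈ P' w := by
  rcases le_total c d with hcd | hcd
  · obtain ⟨e, rfl⟩ := Nat.exists_eq_add_of_le hcd
    exact diff_mem w c e
  · obtain ⟨e, rfl⟩ := Nat.exists_eq_add_of_le hcd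
    rw [← neg_sub]
    exact Submodule.neg_mem _ (diff_mem w d e)

theorem pf_step {c d : ℕ} (hcd : c ≠ d) (a b : ℕ) :
    U c (a + 1) * U d (b + 1) =
      (((d : ℚ) - c)⁻¹) • (U c (a + 1) * U d b - U c a * U d (b + 1)) := by
  ext m
  have h1 : ((m : ℝ) + 1 + c) ≠ 0 := by positivity
  have h2 : ((m : ℝ) + 1 + d) ≠ 0 := by positivity
  have h3 : ((d : ℝ) - c) ≠ 0 := by
    rw [sub_ne_zero]; exact_mod_cast hcd.symm
  simp only [U, Pi.mul_apply, Pi.smul_apply, Pi.sub_apply, Rat.smul_def, pow_succ]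
  push_cast
  field_simp
  ring

theorem pf (c d : ℕ) : ∀ (n a b : ℕ), a + b = n → U c (a + 1) * U d (b + 1) ∈ P' (a + b + 2) := by
  by_cases hcd : c = d
  · subst hcd
    intro n a b _
    rw [U_mul_same]
    exact U_mem_P' (by omega) (by omega)
  intro n
  induction n with
  | zero =>
    intro a b hab
    obtain rfl : a = 0 := by omega
    obtain rfl : b = 0 := by omega
    rw [pf_step hcd, U_zero, U_zero, one_mul, mul_one]
    exact Submodule.smul_mem _ _ (diff_mem' _ _ _)
  | succ n ih =>
    intro a b hab
    rw [pf_step hcd]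
    refine Submodule.smul_mem _ _ (Submodule.sub_mem _ ?_ ?_)
    · cases b with
      | zero =>
        rw [U_zero, mul_one]
        exact U_mem_P' (by omega) (by omega)
      | succ b => exact P'_mono (by omega) (ih a b (by omega))
    · cases a with
      | zero =>
        rw [U_zero, one_mul]
        exact U_mem_P' (by omega) (by omega)
      | succ a => exact P'_mono (by omega) (ih a b (by omega))

theorem pf' (c d : ℕ) {a b : ℕ} (ha : 1 ≤ a) (hb : 1 ≤ b) : U c a * U d b ∈ P' (a + b) := by
  obtain ⟨a, rfl⟩ := Nat.exists_eq_add_of_le' ha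
  obtain ⟨b, rfl⟩ := Nat.exists_eq_add_of_le' hb
  exact P'_mono (by omega) (pf c d _ a b rfl)

theorem U_succ (c k m : ℕ) : U (c + 1) k m = U c k (m + 1) := by
  simp only [U]; push_cast; congr 2; ring

theorem h_cons (k : ℕ) (l : List ℕ) : h (k :: l) = sumOp (U 0 k * h l) := rfl

theorem sumOp_succ (f : ℕ → ℝ) (M : ℕ) : sumOp f (M + 1) = sumOp f M + f M := by
  simp [sumOp_apply, Finset.sum_range_succ]

theorem sumOp_zero (f : ℕ → ℝ) : sumOp f 0 = 0 := by
  simp [sumOp_apply]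

theorem key_cons (c k j : ℕ) (l : List ℕ) :
    sumOp (U (c + 1) k * h (j :: l)) = sumOp (U c k * h (j :: l)) + U c k * h (j :: l)
      - sumOp (U (c + 1) k * U 0 j * h l) := by
  ext M
  induction M with
  | zero => simp [sumOp_zero, h_cons]
  | succ M ih =>
    simp only [Pi.add_apply, Pi.sub_apply, Pi.mul_apply, sumOp_succ] at ih ⊢
    rw [ih, U_succ]
    simp only [h_cons, sumOp_succ, Pi.mul_apply]
    ring

theorem key_nil (c k : ℕ) :
    sumOp (U (c + 1) k * h []) = sumOp (U c k * h []) + U c k * h []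
      - (((1 : ℚ) + c)⁻¹ ^ k) • (1 : ℕ → ℝ) := by
  ext M
  induction M with
  | zero => simp [sumOp_zero, h, U, Rat.smul_def]
  | succ M ih =>
    simp only [Pi.add_apply, Pi.sub_apply, Pi.mul_apply, sumOp_succ] at ih ⊢
    rw [ih, U_succ]
    simp only [h, Pi.one_apply, Pi.smul_apply]
    ring

theorem Mod_mono {w w' d d' : ℕ} (hw : w ≤ w') (hd : d ≤ d') : Mod w d ≤ Mod w' d' := by
  refine Submodule.span_mono ?_
  rintro x ⟨c, k, l, h1, h2, h3, rfl⟩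
  exact ⟨c, k, l, h1, h2.trans hw, h3.trans hd, rfl⟩

theorem gen_mem {w d : ℕ} (c k : ℕ) (l : List ℕ) (h1 : ∀ j ∈ l, 1 ≤ j) (h2 : k + l.sum ≤ w)
    (h3 : l.length ≤ d) : U c k * h l ∈ Mod w d :=
  Submodule.subset_span ⟨c, k, l, h1, h2, h3, rfl⟩

theorem h_mem {w d : ℕ} (l : List ℕ) (h1 : ∀ j ∈ l, 1 ≤ j) (h2 : l.sum ≤ w)
    (h3 : l.length ≤ d) : h l ∈ Mod w d := by
  have := gen_mem (w := w) (d := d) 0 0 l h1 (by omega) h3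
  rwa [U_zero, one_mul] at this

theorem sum_mem (l : List ℕ) : (∀ j ∈ l, 1 ≤ j) → ∀ (w : ℕ) (f : ℕ → ℝ), f ∈ P w →
    sumOp (f * h l) ∈ Mod (w + l.sum) (l.length + 1) := by
  induction l with
  | nil =>
    intro hl w
    suffices P w ≤ (Mod (w + [].sum) ([].length + 1)).comap (sumOp ∘ₗ mulOp (h [])) from
      fun f hf => this hf
    refine Submodule.span_le.2 ?_
    rintro _ ⟨c, k, hk, hkw, rfl⟩
    change sumOp (U c k * h []) ∈ Mod (w + [].sum) ([].length + 1)
    induction c with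
    | zero =>
      rw [← h_cons]
      exact h_mem _ (by simpa using hk) (by simpa using hkw) (by simp)
    | succ c ih =>
      rw [key_nil]
      refine Submodule.sub_mem _ (Submodule.add_mem _ ih ?_) (Submodule.smul_mem _ _ ?_)
      · exact gen_mem _ _ _ hl (by omega) (by simp)
      · exact h_mem [] hl (by simp) (by simp)
  | cons j l ihl =>
    intro hl w
    suffices P w ≤ (Mod (w + (j :: l).sum) ((j :: l).length + 1)).comap
        (sumOp ∘ₗ mulOp (h (j :: l))) from fun f hf => this hf
    refine Submodule.span_le.2 ?_
    rintro _ ⟨c, k, hk, hkw, rfl⟩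
    change sumOp (U c k * h (j :: l)) ∈ Mod (w + (j :: l).sum) ((j :: l).length + 1)
    have hj : 1 ≤ j := hl j (by simp)
    induction c with
    | zero =>
      rw [← h_cons]
      refine h_mem _ ?_ (by simp; omega) (by simp)
      intro i hi
      rcases List.mem_cons.1 hi with rfl | hi
      · exact hk
      · exact hl i hi
    | succ c ih =>
      rw [key_cons]
      refine Submodule.sub_mem _ (Submodule.add_mem _ ih ?_) ?_
      · exact gen_mem _ _ _ hl (by omega) (by simp)
      · refine Mod_mono ?_ ?_ (ihl (fun i hi => hl i (by simp [hi])) (k + j) _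
          (P'_le_P (by omega) (pf' (c + 1) 0 hk hj)))
        · simp; omega
        · simp

theorem Mod_step {w d c k : ℕ} (hk : 1 ≤ k) {f : ℕ → ℝ} (hf : f ∈ Mod w d) :
    sumOp (U c k * f) ∈ Mod (w + k) (d + 1) := by
  suffices Mod w d ≤ (Mod (w + k) (d + 1)).comap (sumOp ∘ₗ mulOp (U c k)) by
    have := this hf
    rw [mul_comm]; exact this
  refine Submodule.span_le.2 ?_
  rintro _ ⟨c', k', l, hl, hw, hd, rfl⟩
  change sumOp (U c' k' * h l * U c k) ∈ Mod (w + k) (d + 1)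
  have e : U c' k' * h l * U c k = (U c' k' * U c k) * h l := by ring
  rw [e]
  refine Mod_mono (w := (k' + k) + l.sum) (by omega) (by omega) (sum_mem l hl (k' + k) _ ?_)
  rcases Nat.eq_zero_or_pos k' with rfl | hk'
  · rw [U_zero, one_mul]
    exact Submodule.subset_span ⟨c, k, hk, by omega, rfl⟩
  · exact P'_le_P (by omega) (pf' c' c hk' hk)


theorem U_nonneg (c k m : ℕ) : 0 ≤ U c k m := by
  unfold U; positivity

theorem h_nonneg (l : List ℕ) (m : ℕ) : 0 ≤ h l m := by
  induction l generalizing m with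
  | nil => simp [h]
  | cons k l ih =>
    rw [h_cons, sumOp_apply]
    exact Finset.sum_nonneg fun i _ => mul_nonneg (U_nonneg _ _ _) (ih i)

theorem U_le (c k m j : ℕ) (hk : j ≤ k) : U c k m ≤ ((m : ℝ) + 1)⁻¹ ^ j := by
  unfold U
  have h0 : (0 : ℝ) ≤ ((m : ℝ) + 1 + c)⁻¹ := by positivity
  have h1 : ((m : ℝ) + 1 + c)⁻¹ ≤ ((m : ℝ) + 1)⁻¹ := by
    apply inv_anti₀ (by positivity); simp
  have h2 : ((m : ℝ) + 1 + c)⁻¹ ≤ 1 := by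
    apply inv_le_one_of_one_le₀
    have : (0 : ℝ) ≤ m := by positivity
    have : (0 : ℝ) ≤ c := by positivity
    linarith
  exact (pow_le_pow_of_le_one h0 h2 hk).trans (pow_le_pow_left₀ h0 h1 j)

theorem h_le (l : List ℕ) (hl : ∀ j ∈ l, 1 ≤ j) (m : ℕ) :
    h l m ≤ 2 ^ l.length * √((m : ℝ) + 1) := by
  induction l generalizing m with
  | nil =>
    simp [h]
  | cons k l ih =>
    have hk : 1 ≤ k := hl k (by simp)
    have ih' := ih (fun i hi => hl i (by simp [hi]))
    rw [h_cons]
    have main : sumOp (U 0 k * h l) m ≤ 2 ^ (k :: l).length * √(m : ℝ) := by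
      induction m with
      | zero => simp [sumOp_zero]
      | succ m ihm =>
        rw [sumOp_succ]
        have h1 := U_le 0 k m 1 hk
        have hp : (0 : ℝ) < (m : ℝ) + 1 := by positivity
        have h2 : U 0 k m * h l m ≤ ((m : ℝ) + 1)⁻¹ ^ 1 * (2 ^ l.length * √((m : ℝ) + 1)) :=
          mul_le_mul h1 (ih' m) (h_nonneg l m) (by positivity)
        have h3 : ((m : ℝ) + 1)⁻¹ * √((m : ℝ) + 1) ≤ 2 * (√((m : ℝ) + 1) - √(m : ℝ)) := by
          have ha := Real.sq_sqrt hp.le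
          have hb := Real.sq_sqrt (Nat.cast_nonneg (α := ℝ) m)
          have hs : 0 < √((m : ℝ) + 1) := Real.sqrt_pos.2 hp
          rw [inv_mul_le_iff₀ hp]
          nth_rewrite 2 [← ha]
          have hle : √(m : ℝ) ≤ √((m : ℝ) + 1) := Real.sqrt_le_sqrt (by linarith)
          have : 1 ≤ √((m : ℝ) + 1) * (2 * (√((m : ℝ) + 1) - √(m : ℝ))) := by
            nlinarith [Real.sqrt_nonneg (m : ℝ)]
          nlinarith
        have h4 := mul_le_mul_of_nonneg_left h3 (by positivity : (0 : ℝ) ≤ 2 ^ l.length)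
        simp only [Pi.mul_apply, List.length_cons, pow_succ, Nat.cast_add, Nat.cast_one] at *
        nlinarith
    refine main.trans ?_
    gcongr
    simp

theorem bdry_tendsto (c k : ℕ) (hk : 1 ≤ k) (l : List ℕ) (hl : ∀ j ∈ l, 1 ≤ j) :
    Tendsto (U c k * h l) atTop (𝓝 0) := by
  have ht : Tendsto (fun m : ℕ => 2 ^ l.length * (√((m : ℝ) + 1))⁻¹) atTop (𝓝 0) := by
    have : Tendsto (fun m : ℕ => √((m : ℝ) + 1)) atTop atTop :=
      Real.tendsto_sqrt_atTop.comp
        (tendsto_atTop_add_const_right _ _ tendsto_natCast_atTop_atTop)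
    simpa using this.inv_tendsto_atTop.const_mul ((2 : ℝ) ^ l.length)
  refine squeeze_zero (fun m => mul_nonneg (U_nonneg _ _ _) (h_nonneg _ _)) (fun m => ?_) ht
  have hp : (0 : ℝ) < (m : ℝ) + 1 := by positivity
  have hs : 0 < √((m : ℝ) + 1) := Real.sqrt_pos.2 hp
  refine (mul_le_mul (U_le c k m 1 hk) (h_le l hl m) (h_nonneg l m) (by positivity)).trans
    (le_of_eq ?_)
  have ha := Real.sq_sqrt hp.le
  rw [pow_one]
  nth_rewrite 1 [← ha]
  field_simp

theorem h_converges (k : ℕ) (hk : 2 ≤ k) (l : List ℕ) (hl : ∀ j ∈ l, 1 ≤ j) :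
    ∃ S, Tendsto (h (k :: l)) atTop (𝓝 S) := by
  have hs : Summable (U 0 k * h l) := by
    have h0 : Summable (fun m : ℕ => 1 / (m : ℝ) ^ (3 / 2 : ℝ)) :=
      Real.summable_one_div_nat_rpow.2 (by norm_num)
    have h1 := ((summable_nat_add_iff 1).2 h0).mul_left ((2 : ℝ) ^ l.length)
    refine Summable.of_nonneg_of_le
      (fun m => mul_nonneg (U_nonneg _ _ _) (h_nonneg _ _)) (fun m => ?_) h1
    have hp : (0 : ℝ) < (m : ℝ) + 1 := by positivity
    refine (mul_le_mul (U_le 0 k m 2 hk) (h_le l hl m) (h_nonneg l m) (by positivity)).trans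
      (le_of_eq ?_)
    have : ((m : ℝ) + 1) ^ 2 = ((m : ℝ) + 1) ^ (3 / 2 : ℝ) * √((m : ℝ) + 1) := by
      rw [Real.sqrt_eq_rpow, ← Real.rpow_add hp, ← Real.rpow_natCast]
      norm_num
    rw [inv_pow, this]
    push_cast
    have hs : 0 < √((m : ℝ) + 1) := Real.sqrt_pos.2 hp
    field_simp
  exact ⟨_, hs.hasSum.tendsto_sum_nat⟩


noncomputable def G : (r : ℕ) → (Fin r → ℕ → ℝ) → ℕ → ℝ
  | 0, _ => 1
  | r + 1, φ => sumOp (φ (Fin.last r) * G r (fun i => φ i.castSucc))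

open Classical in
noncomputable def D : (r : ℕ) → ℕ → Finset (Fin r → ℕ+)
  | 0, _ => Finset.univ
  | r + 1, M => (Finset.range M).biUnion fun m =>
      (D r m).image (fun n => (Fin.snoc n m.succPNat : Fin (r + 1) → ℕ+))

theorem mem_D (r M : ℕ) (n : Fin r → ℕ+) : n ∈ D r M ↔ StrictMono n ∧ ∀ i, (n i : ℕ) ≤ M := by
  induction r generalizing M with
  | zero =>
    exact ⟨fun _ => ⟨Subsingleton.strictMono n, fun i => i.elim0⟩, fun _ => Finset.mem_univ n⟩
  | succ r ih =>
    simp only [D, Finset.mem_biUnion, Finset.mem_range, Finset.mem_image, ih]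
    constructor
    · rintro ⟨m, hm, n, ⟨hn, hnm⟩, rfl⟩
      refine ⟨?_, ?_⟩
      · intro i j hij
        induction j using Fin.lastCases with
        | last =>
          induction i using Fin.lastCases with
          | last => exact absurd hij (lt_irrefl _)
          | cast i =>
            simp only [Fin.snoc_castSucc, Fin.snoc_last]
            rw [← PNat.coe_lt_coe, Nat.succPNat_coe]
            have := hnm i
            omega
        | cast j =>
          induction i using Fin.lastCases with
          | last => exact absurd hij (by simp [Fin.le_last])
          | cast i =>
            simp only [Fin.snoc_castSucc]
            exact hn (by simpa using hij)
      · intro i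
        induction i using Fin.lastCases with
        | last => simp only [Fin.snoc_last, Nat.succPNat_coe]; omega
        | cast i => simp only [Fin.snoc_castSucc]; have := hnm i; omega
    · rintro ⟨hn, hM⟩
      refine ⟨(n (Fin.last r)).natPred, ?_, fun i => n i.castSucc, ⟨?_, ?_⟩, ?_⟩
      · have := hM (Fin.last r)
        have h2 := (n (Fin.last r)).pos
        simp only [PNat.natPred]; omega
      · intro i j hij; exact hn (by simpa using hij)
      · intro i
        have := hn (Fin.castSucc_lt_last i)
        rw [← PNat.coe_lt_coe] at this
        simp only [PNat.natPred]; omega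
      · ext i
        induction i using Fin.lastCases with
        | last => simp
        | cast i => simp

theorem sum_D (r M : ℕ) (φ : Fin r → ℕ → ℝ) :
    ∑ n ∈ D r M, ∏ i, φ i (n i).natPred = G r φ M := by
  induction r generalizing M with
  | zero => simp [D, G]
  | succ r ih =>
    classical
    simp only [D, G, sumOp_apply, Pi.mul_apply]
    rw [Finset.sum_biUnion]
    · refine Finset.sum_congr rfl fun m _ => ?_
      rw [Finset.sum_image, ← ih, Finset.mul_sum]
      · refine Finset.sum_congr rfl fun n _ => ?_
        rw [Fin.prod_univ_castSucc, mul_comm]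
        simp
      · intro a _ b _ hab
        exact (Fin.snoc_injective2 hab).1
    · intro a _ b _ hab
      simp only [Function.onFun]
      rw [Finset.disjoint_left]
      intro x hx hy
      obtain ⟨p, _, rfl⟩ := Finset.mem_image.1 hx
      obtain ⟨q, _, hq⟩ := Finset.mem_image.1 hy
      have := (Fin.snoc_injective2 hq).2
      exact hab (Nat.succPNat_injective this).symm

theorem hasSum_of_tendsto (r : ℕ) (φ : Fin r → ℕ → ℝ) (hφ : ∀ i m, 0 ≤ φ i m) (S : ℝ)
    (hS : Tendsto (G r φ) atTop (𝓝 S)) :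
    HasSum (fun n : {n : Fin r → ℕ+ // StrictMono n} => ∏ i, φ i (n.1 i).natPred) S := by
  classical
  have hmono : Monotone fun s : Finset {n : Fin r → ℕ+ // StrictMono n} =>
      ∑ n ∈ s, ∏ i, φ i (n.1 i).natPred := by
    intro s t hst
    exact Finset.sum_le_sum_of_subset_of_nonneg hst
      fun n _ _ => Finset.prod_nonneg fun i _ => hφ _ _
  have hE : Tendsto (fun M => (D r M).subtype StrictMono) atTop atTop := by
    refine tendsto_atTop_finset_of_monotone ?_ ?_
    · intro a b hab n hn
      simp only [Finset.mem_subtype, mem_D] at hn ⊢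
      exact ⟨hn.1, fun i => (hn.2 i).trans hab⟩
    · intro n
      refine ⟨∑ i, (n.1 i : ℕ), ?_⟩
      simp only [Finset.mem_subtype, mem_D]
      exact ⟨n.2, fun i => Finset.single_le_sum (f := fun i => (n.1 i : ℕ))
        (fun _ _ => Nat.zero_le _) (Finset.mem_univ i)⟩
  refine (tendsto_iff_tendsto_subseq_of_monotone hmono hE).2 ?_
  refine hS.congr fun M => ?_
  simp only [Function.comp]
  rw [← sum_D, Finset.sum_subtype_of_mem (f := fun n : Fin r → ℕ+ => ∏ i, φ i (n i).natPred)]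
  intro n hn
  exact ((mem_D r M n).1 hn).1

theorem natPred_cast (n : ℕ+) : ((n.natPred : ℕ) : ℝ) + 1 = (n : ℝ) := by
  have := n.natPred_add_one
  exact_mod_cast this

theorem list_tuple (l : List ℕ) (hl : ∀ j ∈ l, 1 ≤ j) :
    ∃ κ : Fin l.length → ℕ, (∀ i, 1 ≤ κ i) ∧ ∑ i, κ i = l.sum ∧
      h l = G l.length (fun i => U 0 (κ i)) := by
  induction l with
  | nil => exact ⟨fun _ => 1, by simp, by simp, rfl⟩
  | cons k l ih =>
    obtain ⟨κ, h1, h2, h3⟩ := ih (fun i hi => hl i (by simp [hi]))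
    refine ⟨(Fin.snoc κ k : Fin (l.length + 1) → ℕ), ?_, ?_, ?_⟩
    · intro i
      change Fin (l.length + 1) at i
      induction i using Fin.lastCases with
      | last => simpa using hl k (by simp)
      | cast i => simpa using h1 i
    · change ∑ i : Fin (l.length + 1), _ = _
      rw [Fin.sum_univ_castSucc]
      simp [h2, add_comm]
    · change _ = G (l.length + 1) _
      simp only [G, Fin.snoc_last, Fin.snoc_castSucc]
      rw [← h3, h_cons]

theorem mzv_tendsto (k : ℕ) (hk : 2 ≤ k) (l : List ℕ) (hl : ∀ j ∈ l, 1 ≤ j) (w d : ℕ)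
    (hw : k + l.sum ≤ w) (hd : l.length + 1 ≤ d) :
    ∃ S ∈ mzvSet w d, Tendsto (h (k :: l)) atTop (𝓝 S) := by
  obtain ⟨S, hS⟩ := h_converges k hk l hl
  refine ⟨S, ?_, hS⟩
  obtain ⟨κ, h1, h2, h3⟩ := list_tuple l hl
  have h4 : h (k :: l) = G (l.length + 1)
      (fun i => U 0 ((Fin.snoc κ k : Fin (l.length + 1) → ℕ) i)) := by
    simp only [G, Fin.snoc_last, Fin.snoc_castSucc]
    rw [← h3, h_cons]
  rw [h4] at hS
  have h5 := hasSum_of_tendsto _ _ (fun i m => U_nonneg _ _ _) _ hS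
  refine ⟨l.length + 1, (Fin.snoc κ k : Fin (l.length + 1) → ℕ), ?_, ?_, ?_, hd, ?_⟩
  · intro i
    induction i using Fin.lastCases with
    | last => simp only [Fin.snoc_last]; omega
    | cast i => simpa using h1 i
  · intro i hi
    obtain rfl : i = Fin.last _ := by ext; simpa using hi
    simpa using hk
  · rw [Fin.sum_univ_castSucc]
    simp only [Fin.snoc_castSucc, Fin.snoc_last, h2]
    omega
  · rw [← h5.tsum_eq]
    refine tsum_congr fun n => Finset.prod_congr rfl fun i _ => ?_
    simp only [U, natPred_cast, Nat.cast_zero, add_zero]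

theorem one_mem (w d : ℕ) : (1 : ℝ) ∈ Submodule.span ℚ (mzvSet w d) := by
  refine Submodule.subset_span ⟨0, fun _ => 1, by simp, by simp, by simp, by simp, ?_⟩
  have hS : Tendsto (G 0 fun _ _ => 0) atTop (𝓝 1) := tendsto_const_nhds
  have := (hasSum_of_tendsto 0 _ (by simp) 1 hS).tsum_eq
  simpa using this.symm

/-- Sequences whose series converges to an element of the span of MZVs. -/
noncomputable def L (w d : ℕ) : Submodule ℚ (ℕ → ℝ) where
  carrier := {f | ∃ S ∈ Submodule.span ℚ (mzvSet w d), Tendsto f atTop (𝓝 S)}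
  add_mem' := by
    rintro f g ⟨S, hS, hf⟩ ⟨T, hT, hg⟩
    exact ⟨S + T, Submodule.add_mem _ hS hT, hf.add hg⟩
  zero_mem' := ⟨0, Submodule.zero_mem _, tendsto_const_nhds⟩
  smul_mem' := by
    rintro q f ⟨S, hS, hf⟩
    exact ⟨q • S, Submodule.smul_mem _ _ hS, hf.const_smul q⟩

theorem mzvSet_mono {w w' d d' : ℕ} (hw : w ≤ w') (hd : d ≤ d') : mzvSet w d ⊆ mzvSet w' d' := by
  rintro x ⟨r, k, h1, h2, h3, h4, h5⟩
  exact ⟨r, k, h1, h2, h3.trans hw, h4.trans hd, h5⟩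

theorem L_mono {w w' d d' : ℕ} (hw : w ≤ w') (hd : d ≤ d') : L w d ≤ L w' d' := by
  rintro f ⟨S, hS, hf⟩
  exact ⟨S, Submodule.span_mono (mzvSet_mono hw hd) hS, hf⟩

theorem bdry_L {w d : ℕ} (c k : ℕ) (hk : 1 ≤ k) (l : List ℕ) (hl : ∀ j ∈ l, 1 ≤ j) :
    U c k * h l ∈ L w d :=
  ⟨0, Submodule.zero_mem _, bdry_tendsto c k hk l hl⟩

theorem one_L (w d : ℕ) : (1 : ℕ → ℝ) ∈ L w d :=
  ⟨1, one_mem w d, tendsto_const_nhds⟩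

theorem sum_L (l : List ℕ) : (∀ j ∈ l, 1 ≤ j) → ∀ (w : ℕ) (_ : 1 ≤ w) (f : ℕ → ℝ), f ∈ P' w →
    sumOp (f * h l) ∈ L (w + l.sum) (l.length + 1) := by
  induction l with
  | nil =>
    intro hl w hw
    suffices P' w ≤ (L (w + [].sum) ([].length + 1)).comap (sumOp ∘ₗ mulOp (h [])) from
      fun f hf => this hf
    refine Submodule.span_le.2 ?_
    rintro _ (⟨c, k, hk, hkw, rfl⟩ | ⟨c, rfl⟩)
    · change sumOp (U c k * h []) ∈ L (w + [].sum) ([].length + 1)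
      induction c with
      | zero =>
        rw [← h_cons]
        obtain ⟨S, hS, ht⟩ := mzv_tendsto k hk [] hl (w + [].sum) ([].length + 1)
          (by simpa using hkw) le_rfl
        exact ⟨S, Submodule.subset_span hS, ht⟩
      | succ c ih =>
        rw [key_nil]
        exact Submodule.sub_mem _ (Submodule.add_mem _ ih (bdry_L _ _ (by omega) _ hl))
          (Submodule.smul_mem _ _ (one_L _ _))
    · change sumOp ((U c 1 - U (c + 1) 1) * h []) ∈ L (w + [].sum) ([].length + 1)
      rw [sub_mul, map_sub, key_nil, sub_sub_eq_add_sub, add_sub_add_left_eq_sub]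
      exact Submodule.sub_mem _ (Submodule.smul_mem _ _ (one_L _ _)) (bdry_L _ _ le_rfl _ hl)
  | cons j l ihl =>
    intro hl w hw
    suffices P' w ≤ (L (w + (j :: l).sum) ((j :: l).length + 1)).comap
        (sumOp ∘ₗ mulOp (h (j :: l))) from fun f hf => this hf
    have hj : 1 ≤ j := hl j (by simp)
    have rest : ∀ c k, 1 ≤ k → k ≤ w →
        sumOp (U (c + 1) k * U 0 j * h l) ∈ L (w + (j :: l).sum) ((j :: l).length + 1) := by
      intro c k hk hkw
      refine L_mono ?_ ?_ (ihl (fun i hi => hl i (by simp [hi])) (k + j) (by omega) _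
          (pf' (c + 1) 0 hk hj))
      · simp; omega
      · simp
    refine Submodule.span_le.2 ?_
    rintro _ (⟨c, k, hk, hkw, rfl⟩ | ⟨c, rfl⟩)
    · change sumOp (U c k * h (j :: l)) ∈ L (w + (j :: l).sum) ((j :: l).length + 1)
      induction c with
      | zero =>
        rw [← h_cons]
        obtain ⟨S, hS, ht⟩ := mzv_tendsto k hk (j :: l) hl (w + (j :: l).sum)
          ((j :: l).length + 1) (by omega) le_rfl
        exact ⟨S, Submodule.subset_span hS, ht⟩
      | succ c ih =>
        rw [key_cons]
        exact Submodule.sub_mem _ (Submodule.add_mem _ ih (bdry_L _ _ (by omega) _ hl))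
          (rest c k (by omega) hkw)
    · change sumOp ((U c 1 - U (c + 1) 1) * h (j :: l)) ∈ L (w + (j :: l).sum) ((j :: l).length + 1)
      rw [sub_mul, map_sub, key_cons, sub_sub_eq_add_sub, add_sub_add_left_eq_sub]
      exact Submodule.sub_mem _ (rest c 1 le_rfl hw) (bdry_L _ _ le_rfl _ hl)

theorem L_step {w d c k : ℕ} (hk : 2 ≤ k) {f : ℕ → ℝ} (hf : f ∈ Mod w d) :
    sumOp (U c k * f) ∈ L (w + k) (d + 1) := by
  suffices Mod w d ≤ (L (w + k) (d + 1)).comap (sumOp ∘ₗ mulOp (U c k)) by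
    have := this hf
    rw [mul_comm]; exact this
  refine Submodule.span_le.2 ?_
  rintro _ ⟨c', k', l, hl, hw, hd, rfl⟩
  change sumOp (U c' k' * h l * U c k) ∈ L (w + k) (d + 1)
  have e : U c' k' * h l * U c k = (U c' k' * U c k) * h l := by ring
  rw [e]
  refine L_mono (w := (k' + k) + l.sum) (by omega) (by omega)
    (sum_L l hl (k' + k) (by omega) _ ?_)
  rcases Nat.eq_zero_or_pos k' with rfl | hk'
  · rw [U_zero, one_mul]
    exact U_mem_P' hk (by omega)
  · exact pf' c' c hk' (by omega)

theorem G_mem (r : ℕ) (c k : Fin r → ℕ) (hk : ∀ i, 1 ≤ k i) :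
    G r (fun i => U (c i) (k i)) ∈ Mod (∑ i, k i) r := by
  induction r with
  | zero => exact h_mem [] (by simp) (by simp) (by simp)
  | succ r ih =>
    rw [Fin.sum_univ_castSucc]
    exact Mod_step (hk _) (ih (fun i => c i.castSucc) (fun i => k i.castSucc) fun i => hk _)

end MZVaux

/-- Σ_{0<n₁<⋯<n_r} 1/∏ (n_i+c_i)^{k_i} converges and is a ℚ-linear combination
of multiple zeta values of weight ≤ Σ k_i and depth ≤ r. -/
theorem stmt_10 (r : ℕ) (hr : 1 ≤ r) (c : Fin r → ℕ) (k : Fin r → ℕ)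
    (hk : ∀ i, 1 ≤ k i) (hlast : 2 ≤ k ⟨r - 1, by omega⟩) :
    Summable (fun n : {n : Fin r → ℕ+ // StrictMono n} =>
        (1 : ℝ) / ∏ i, ((n.1 i : ℝ) + (c i : ℝ)) ^ (k i)) ∧
    (∑' n : {n : Fin r → ℕ+ // StrictMono n},
        (1 : ℝ) / ∏ i, ((n.1 i : ℝ) + (c i : ℝ)) ^ (k i))
      ∈ Submodule.span ℚ (mzvSet (∑ i, k i) r) := by
  obtain ⟨r, rfl⟩ := Nat.exists_eq_add_of_le' hr
  have hlast' : 2 ≤ k (Fin.last r) := hlast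
  obtain ⟨S, hS, ht⟩ := MZVaux.L_step (c := c (Fin.last r)) hlast'
    (MZVaux.G_mem r (fun i => c i.castSucc) (fun i => k i.castSucc) fun i => hk _)
  rw [← Fin.sum_univ_castSucc] at hS
  have h5 := MZVaux.hasSum_of_tendsto (r + 1) (fun i => MZVaux.U (c i) (k i))
    (fun i m => MZVaux.U_nonneg _ _ _) S ht
  have e : (fun n : {n : Fin (r + 1) → ℕ+ // StrictMono n} =>
        (1 : ℝ) / ∏ i, ((n.1 i : ℝ) + (c i : ℝ)) ^ (k i)) =
      fun n => ∏ i, MZVaux.U (c i) (k i) (n.1 i).natPred := by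
    ext n
    simp only [MZVaux.U, MZVaux.natPred_cast, inv_pow, Finset.prod_inv_distrib, one_div]
  rw [e]
  exact ⟨h5.summable, by rw [h5.tsum_eq]; exact hS⟩
end
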